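/- Let n ≥ 1, let W = (w_{ij}) be a real n × n matrix, and let g, h be continuously differentiable with g₀ = ∂g/∂x(0,0), h₁ = ∂h/∂x₁(0,0,0), h₂ = ∂h/∂x₂(0,0,0), and assume h₂ = −h₁. Let D be the diagonal matrix with D_{ii} = Σ_j w_{ij} and L = D − W the weighted Laplacian matrix. Let F be the input-additive admissible system built from W, g, h, and let J be the Jacobian matrix of x ↦ F(x, 0) at x = 0. Then J = g₀·I_n + h₁·L, and if μ₁, …, μ_n ∈ ℂ are the eigenvalues of L counted with algebraic multiplicity, the characteristic polynomial of J equals ∏_{j=1}^n (X − (g₀ + h₁·μ_j)). -/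

import Mathlib

open Matrix Polynomial

/-- The input-additive admissible coupled cell system associated with a weighted
adjacency matrix `W`, internal dynamics `g` and coupling function `h`:
`F_i(x, λ) = g(x_i, λ) + ∑_j w_{ij} h(x_i, x_j, λ)`. -/
def admissF {ι : Type*} [Fintype ι] (W : Matrix ι ι ℝ) (g : ℝ → ℝ → ℝ)
    (h : ℝ → ℝ → ℝ → ℝ) (x : ι → ℝ) (lam : ℝ) (i : ι) : ℝ :=
  g (x i) lam + ∑ j, W i j * h (x i) (x j) lam

/-- If `μ` lists the eigenvalues of `M` with multiplicity, then `a + b * μ` lists those of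
`a • 1 + b • M`. -/
theorem charpoly_smul_one_add_smul {K ι : Type*} [Field K] [Infinite K] [Fintype ι]
    [DecidableEq ι] (M : Matrix ι ι K) (a b : K) (μ : ι → K)
    (hμ : M.charpoly = ∏ j, (X - C (μ j))) :
    (a • (1 : Matrix ι ι K) + b • M).charpoly = ∏ j, (X - C (a + b * μ j)) := by
  refine Polynomial.funext fun t => ?_
  simp only [Matrix.eval_charpoly, eval_prod, eval_sub, eval_X, eval_C]
  rcases eq_or_ne b 0 with rfl | hb
  · have key : scalar ι t - (a • (1 : Matrix ι ι K) + (0 : K) • M) = (t - a) • 1 := by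
      rw [scalar_apply, ← smul_one_eq_diagonal]
      module
    rw [key]
    simp
  · have key : scalar ι t - (a • (1 : Matrix ι ι K) + b • M) =
        b • (scalar ι ((t - a) / b) - M) := by
      ext i j
      by_cases hij : i = j
      · subst hij
        simp
        field_simp
        ring
      · simp [hij]
    rw [key, det_smul, ← Matrix.eval_charpoly, hμ, eval_prod, ← Finset.card_univ,
      ← Finset.prod_const, ← Finset.prod_mul_distrib]
    refine Finset.prod_congr rfl fun j _ => ?_
    simp only [eval_sub, eval_X, eval_C]
    field_simp
    ring

theorem hasFDerivAt_internal {ι : Type*} [Fintype ι] {g : ℝ → ℝ → ℝ}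
    (hg : DifferentiableAt ℝ (fun p : ℝ × ℝ => g p.1 p.2) 0) (i : ι) :
    HasFDerivAt (fun x : ι → ℝ => g (x i) 0)
      (deriv (fun x => g x 0) 0 • ContinuousLinearMap.proj (R := ℝ) (φ := fun _ : ι => ℝ) i) 0 := by
  have hd : DifferentiableAt ℝ (fun x => g x 0) 0 :=
    DifferentiableAt.comp (𝕜 := ℝ) (g := fun p : ℝ × ℝ => g p.1 p.2) (f := fun x : ℝ => (x, (0 : ℝ)))
      0 hg (by fun_prop)
  exact HasDerivAt.comp_hasFDerivAt (h₂ := fun x => g x 0) (f := fun x : ι → ℝ => x i) 0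
    hd.hasDerivAt (hasFDerivAt_apply i 0)

theorem hasFDerivAt_coupling {ι : Type*} [Fintype ι] {h : ℝ → ℝ → ℝ → ℝ}
    (hh : DifferentiableAt ℝ (fun p : ℝ × ℝ × ℝ => h p.1 p.2.1 p.2.2) 0) (i j : ι) :
    HasFDerivAt (fun x : ι → ℝ => h (x i) (x j) 0)
      (deriv (fun x => h x 0 0) 0 • ContinuousLinearMap.proj (R := ℝ) (φ := fun _ : ι => ℝ) i +
        deriv (fun y => h 0 y 0) 0 • ContinuousLinearMap.proj (R := ℝ) (φ := fun _ : ι => ℝ) j)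
      0 := by
  set H : ℝ × ℝ × ℝ → ℝ := fun p => h p.1 p.2.1 p.2.2
  have hH : HasFDerivAt H (fderiv ℝ H 0) 0 := hh.hasFDerivAt
  have e₁ : deriv (fun x => h x 0 0) 0 = fderiv ℝ H 0 (1, 0, 0) :=
    (HasFDerivAt.comp_hasDerivAt (l := H) (f := fun x : ℝ => (x, (0 : ℝ), (0 : ℝ))) 0 hH
      ((hasDerivAt_id (0 : ℝ)).prodMk (hasDerivAt_const (0 : ℝ) ((0 : ℝ), (0 : ℝ))))).deriv
  have e₂ : deriv (fun y => h 0 y 0) 0 = fderiv ℝ H 0 (0, 1, 0) :=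
    (HasFDerivAt.comp_hasDerivAt (l := H) (f := fun y : ℝ => ((0 : ℝ), y, (0 : ℝ))) 0 hH
      ((hasDerivAt_const (0 : ℝ) (0 : ℝ)).prodMk
        ((hasDerivAt_id (0 : ℝ)).prodMk (hasDerivAt_const (0 : ℝ) (0 : ℝ))))).deriv
  have hc := HasFDerivAt.comp (g := H) (f := fun x : ι → ℝ => (x i, x j, (0 : ℝ))) 0 hH
    ((hasFDerivAt_apply i 0).prodMk
      ((hasFDerivAt_apply j 0).prodMk (hasFDerivAt_const (0 : ℝ) (0 : ι → ℝ))))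
  refine hc.congr_fderiv (ContinuousLinearMap.ext fun v => ?_)
  have hv : (v i, v j, (0 : ℝ)) = v i • ((1 : ℝ), (0 : ℝ), (0 : ℝ)) + v j • (0, 1, 0) := by simp
  change fderiv ℝ H 0 (v i, v j, 0) = _ * v i + _ * v j
  rw [hv, map_add, map_smul, map_smul, e₁, e₂, smul_eq_mul, smul_eq_mul]
  ring

theorem hasFDerivAt_admissF {ι : Type*} [Fintype ι] (W : Matrix ι ι ℝ) {g : ℝ → ℝ → ℝ}
    {h : ℝ → ℝ → ℝ → ℝ} (hg : DifferentiableAt ℝ (fun p : ℝ × ℝ => g p.1 p.2) 0)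
    (hh : DifferentiableAt ℝ (fun p : ℝ × ℝ × ℝ => h p.1 p.2.1 p.2.2) 0) (i : ι) :
    HasFDerivAt (fun x : ι → ℝ => admissF W g h x 0 i)
      (deriv (fun x => g x 0) 0 • ContinuousLinearMap.proj (R := ℝ) (φ := fun _ : ι => ℝ) i +
        ∑ j, W i j •
          (deriv (fun x => h x 0 0) 0 • ContinuousLinearMap.proj (R := ℝ) (φ := fun _ : ι => ℝ) i +
            deriv (fun y => h 0 y 0) 0 •
              ContinuousLinearMap.proj (R := ℝ) (φ := fun _ : ι => ℝ) j)) 0 :=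
  (hasFDerivAt_internal hg i).add
    (HasFDerivAt.fun_sum fun j _ => (hasFDerivAt_coupling hh i j).const_mul (W i j))

/-- If `h₂ = −h₁` then the Jacobian of the admissible system at the origin equals
`g₀ I + h₁ L`, where `L = D − W` is the weighted Laplacian; in particular if
`μ₁, …, μ_n` are the complex eigenvalues of `L` counted with algebraic multiplicity,
the characteristic polynomial of `J` is `∏_j (X − (g₀ + h₁ μ_j))`. -/
theorem statement2 (n : ℕ) (hn : 1 ≤ n) (W : Matrix (Fin n) (Fin n) ℝ)
    (g : ℝ → ℝ → ℝ) (h : ℝ → ℝ → ℝ → ℝ)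
    (hg : ContDiff ℝ 1 (fun p : ℝ × ℝ => g p.1 p.2))
    (hh : ContDiff ℝ 1 (fun p : ℝ × ℝ × ℝ => h p.1 p.2.1 p.2.2))
    (g₀ h₁ h₂ : ℝ)
    (hg₀ : g₀ = deriv (fun x => g x 0) 0)
    (hh₁ : h₁ = deriv (fun x => h x 0 0) 0)
    (hh₂ : h₂ = deriv (fun y => h 0 y 0) 0)
    (hdiff : h₂ = -h₁)
    (D : Matrix (Fin n) (Fin n) ℝ)
    (hD : D = Matrix.diagonal fun i => ∑ j, W i j)
    (L : Matrix (Fin n) (Fin n) ℝ) (hL : L = D - W)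
    (J : Matrix (Fin n) (Fin n) ℝ)
    (hJ : ∀ i j, J i j =
      fderiv ℝ (fun x : Fin n → ℝ => admissF W g h x 0 i) 0 (Pi.single j 1))
    (μ : Fin n → ℂ)
    (hμ : (L.map (algebraMap ℝ ℂ)).charpoly = ∏ j, (X - C (μ j))) :
    J = g₀ • (1 : Matrix (Fin n) (Fin n) ℝ) + h₁ • L ∧
    (J.map (algebraMap ℝ ℂ)).charpoly =
      ∏ j, (X - C ((g₀ : ℂ) + (h₁ : ℂ) * μ j)) := by
  have hJL : J = g₀ • (1 : Matrix (Fin n) (Fin n) ℝ) + h₁ • L := by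
    ext i k
    rw [hJ, (hasFDerivAt_admissF W (hg.differentiable one_ne_zero 0)
      (hh.differentiable one_ne_zero 0) i).fderiv, ← hg₀, ← hh₁, ← hh₂, hdiff, hL, hD]
    by_cases hik : i = k
    · subst hik
      simp [Pi.single_apply, Finset.sum_add_distrib, ← Finset.sum_mul]
      ring
    · simp [Pi.single_apply, hik, mul_comm]
  refine ⟨hJL, ?_⟩
  have hmap : J.map (algebraMap ℝ ℂ) =
      (g₀ : ℂ) • (1 : Matrix (Fin n) (Fin n) ℂ) + (h₁ : ℂ) • L.map (algebraMap ℝ ℂ) := by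
    ext i j
    by_cases hij : i = j <;> simp [hJL, hij]
  rw [hmap]
  exact charpoly_smul_one_add_smul _ _ _ μ hμ
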